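/- Let X and Y be independent identically distributed real random variables. Then for any c > 0, P(|X+Y| ≤ c) < 2·P(|X−Y| ≤ c). -/

import Mathlib

open MeasureTheory ProbabilityTheory

noncomputable def kk (c x y : ℝ) : ℝ :=
  2 * (if |x - y| ≤ c then 1 else 0) - (if |x + y| ≤ c then 1 else 0)

lemma kk_symm (c x y : ℝ) : kk c x y = kk c y x := by
  unfold kk; rw [abs_sub_comm, add_comm]

lemma kk_le (c x y : ℝ) : kk c x y ≤ 2 := by
  unfold kk; split_ifs <;> norm_num

lemma kk_ge (c x y : ℝ) : -1 ≤ kk c x y := by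
  unfold kk; split_ifs <;> norm_num

lemma row_pos {ι : Type*} [DecidableEq ι] (c : ℝ) (hc : 0 < c) (x : ι → ℝ) (s : Finset ι)
    (hs : s.Nonempty) : ∃ i ∈ s, 1 ≤ ∑ j ∈ s, kk c (x i) (x j) := by
  classical
  let t : ι → ℕ := fun i => (s.filter (fun j => |x i - x j| ≤ c)).card
  obtain ⟨i, hi, hmax⟩ := s.exists_max_image (fun i => toLex (t i, |x i|)) hs
  refine ⟨i, hi, ?_⟩
  have h1 : ∀ j ∈ s, t j ≤ t i := by
    intro j hj
    have := hmax j hj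
    rw [Prod.Lex.toLex_le_toLex] at this
    rcases this with h | h
    · exact h.le
    · exact h.1.le
  have h2 : ∀ j ∈ s, |x i| < |x j| → t j + 1 ≤ t i := by
    intro j hj hlt
    have := hmax j hj
    rw [Prod.Lex.toLex_le_toLex] at this
    rcases this with h | h
    · exact h
    · exact absurd h.2 (not_le.mpr hlt)
  have hti : 1 ≤ t i := Finset.card_pos.mpr ⟨i, by simp [hi, hc.le]⟩
  -- subsets of diameter at most c
  have hA : ∀ u ⊆ s, (∀ j ∈ u, ∀ l ∈ u, |x j - x l| ≤ c) → u.card ≤ t i := by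
    intro u hu hd
    rcases u.eq_empty_or_nonempty with rfl | ⟨j, hj⟩
    · simp
    · refine le_trans (Finset.card_le_card ?_) (h1 j (hu hj))
      intro l hl
      simp [hu hl, hd j hj l hl]
  have hB : ∀ u ⊆ s, (∀ j ∈ u, ∀ l ∈ u, |x j - x l| ≤ c) → (∀ j ∈ u, |x i| < |x j|) →
      u.card + 1 ≤ t i := by
    intro u hu hd hl
    rcases u.eq_empty_or_nonempty with rfl | ⟨j, hj⟩
    · simpa using hti
    · refine le_trans (Nat.succ_le_succ (Finset.card_le_card ?_)) (h2 j (hu hj) (hl j hj))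
      intro l hl
      simp [hu hl, hd j hj l hl]
  have key : (s.filter (fun j => |x i + x j| ≤ c)).card + 1 ≤ 2 * t i := by
    rcases le_total 0 (x i) with h0 | h0
    · have a := hA (s.filter (fun j => -x i ≤ x j ∧ x j ≤ -x i + c)) (Finset.filter_subset _ _)
        (by
          intro j hj l hl
          simp only [Finset.mem_filter] at hj hl
          rw [abs_le]; constructor <;> linarith [hj.2.1, hj.2.2, hl.2.1, hl.2.2])
      have b := hB (s.filter (fun j => -x i - c ≤ x j ∧ x j < -x i)) (Finset.filter_subset _ _)
        (by
          intro j hj l hl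
          simp only [Finset.mem_filter] at hj hl
          rw [abs_le]; constructor <;> linarith [hj.2.1, hj.2.2, hl.2.1, hl.2.2])
        (by
          intro j hj
          simp only [Finset.mem_filter] at hj
          rw [abs_of_nonneg h0, lt_abs]; right; linarith [hj.2.2])
      have d : s.filter (fun j => |x i + x j| ≤ c) ⊆
          s.filter (fun j => -x i ≤ x j ∧ x j ≤ -x i + c) ∪
          s.filter (fun j => -x i - c ≤ x j ∧ x j < -x i) := by
        intro j hj
        simp only [Finset.mem_filter, Finset.mem_union, abs_le] at hj ⊢
        rcases le_or_gt (-x i) (x j) with h | h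
        · left; exact ⟨hj.1, h, by linarith [hj.2.2]⟩
        · right; exact ⟨hj.1, by linarith [hj.2.1], h⟩
      have := (Finset.card_le_card d).trans (Finset.card_union_le _ _)
      omega
    · have a := hA (s.filter (fun j => -x i - c ≤ x j ∧ x j ≤ -x i)) (Finset.filter_subset _ _)
        (by
          intro j hj l hl
          simp only [Finset.mem_filter] at hj hl
          rw [abs_le]; constructor <;> linarith [hj.2.1, hj.2.2, hl.2.1, hl.2.2])
      have b := hB (s.filter (fun j => -x i < x j ∧ x j ≤ -x i + c)) (Finset.filter_subset _ _)
        (by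
          intro j hj l hl
          simp only [Finset.mem_filter] at hj hl
          rw [abs_le]; constructor <;> linarith [hj.2.1, hj.2.2, hl.2.1, hl.2.2])
        (by
          intro j hj
          simp only [Finset.mem_filter] at hj
          rw [abs_of_nonpos h0, lt_abs]; left; linarith [hj.2.1])
      have d : s.filter (fun j => |x i + x j| ≤ c) ⊆
          s.filter (fun j => -x i - c ≤ x j ∧ x j ≤ -x i) ∪
          s.filter (fun j => -x i < x j ∧ x j ≤ -x i + c) := by
        intro j hj
        simp only [Finset.mem_filter, Finset.mem_union, abs_le] at hj ⊢
        rcases le_or_gt (x j) (-x i) with h | h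
        · left; exact ⟨hj.1, by linarith [hj.2.1], h⟩
        · right; exact ⟨hj.1, h, by linarith [hj.2.2]⟩
      have := (Finset.card_le_card d).trans (Finset.card_union_le _ _)
      omega
  have e : ∑ j ∈ s, kk c (x i) (x j) =
      2 * (t i : ℝ) - ((s.filter (fun j => |x i + x j| ≤ c)).card : ℝ) := by
    simp only [kk, Finset.sum_sub_distrib, ← Finset.mul_sum, Finset.sum_boole, t]
  rw [e]
  have : (((s.filter (fun j => |x i + x j| ≤ c)).card + 1 : ℕ) : ℝ) ≤ ((2 * t i : ℕ) : ℝ) :=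
    Nat.cast_le.mpr key
  push_cast at this
  linarith

lemma finite_nonneg {ι : Type*} [DecidableEq ι] (c : ℝ) (hc : 0 < c) (x : ι → ℝ) (n : ℕ) :
    ∀ s : Finset ι, s.card = n → 0 ≤ ∑ i ∈ s, ∑ j ∈ s, kk c (x i) (x j) := by
  induction n with
  | zero => intro s hs; rw [Finset.card_eq_zero] at hs; simp [hs]
  | succ n ih =>
    intro s hs
    obtain ⟨i, hi, hrow⟩ := row_pos c hc x s (Finset.card_pos.mp (by omega))
    have h := ih (s.erase i) (by rw [Finset.card_erase_of_mem hi]; omega)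
    have e1 : ∑ a ∈ s, ∑ j ∈ s, kk c (x a) (x j) =
        ∑ a ∈ s.erase i, ∑ j ∈ s, kk c (x a) (x j) + ∑ j ∈ s, kk c (x i) (x j) :=
      (Finset.sum_erase_add _ _ hi).symm
    have e2 : ∑ a ∈ s.erase i, ∑ j ∈ s, kk c (x a) (x j) =
        ∑ a ∈ s.erase i, ∑ j ∈ s.erase i, kk c (x a) (x j) +
          ∑ a ∈ s.erase i, kk c (x a) (x i) := by
      rw [← Finset.sum_add_distrib]
      exact Finset.sum_congr rfl fun a _ => (Finset.sum_erase_add _ _ hi).symm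
    have e3 : ∑ a ∈ s.erase i, kk c (x a) (x i) + kk c (x i) (x i) =
        ∑ j ∈ s, kk c (x i) (x j) := by
      rw [Finset.sum_erase_add _ _ hi]
      exact Finset.sum_congr rfl fun a _ => kk_symm _ _ _
    have := kk_le c (x i) (x i)
    linarith

lemma kk_meas (c : ℝ) : Measurable (fun z : ℝ × ℝ => kk c z.1 z.2) := by
  unfold kk
  refine Measurable.sub (Measurable.const_mul (Measurable.ite ?_ measurable_const measurable_const) _)
    (Measurable.ite ?_ measurable_const measurable_const)
  · exact measurableSet_le (by fun_prop) measurable_const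
  · exact measurableSet_le (by fun_prop) measurable_const

lemma kk_integrable {α : Type*} [MeasurableSpace α] (ν : Measure α) [IsFiniteMeasure ν] (c : ℝ)
    (f g : α → ℝ) (hf : Measurable f) (hg : Measurable g) :
    Integrable (fun a => kk c (f a) (g a)) ν := by
  refine Integrable.of_bound ((kk_meas c).comp (hf.prodMk hg)).aestronglyMeasurable 2
    (Filter.Eventually.of_forall fun a => ?_)
  rw [Real.norm_eq_abs, abs_le]
  exact ⟨by linarith [kk_ge c (f a) (g a)], kk_le _ _ _⟩

lemma sample (c : ℝ) (hc : 0 < c) (μ : Measure ℝ) [IsProbabilityMeasure μ] (a : ℝ) (m p : ℕ) :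
    0 ≤ (m : ℝ) * (m - 1) * (∫ z, kk c z.1 z.2 ∂(μ.prod μ)) + 2 * m
      + 2 * m * p * (∫ y, kk c a y ∂μ) + 2 * p ^ 2 := by
  classical
  set Q := ∫ z, kk c z.1 z.2 ∂(μ.prod μ) with hQ
  set L := ∫ y, kk c a y ∂μ with hL
  let ρ : Measure (Fin m → ℝ) := Measure.pi (fun _ => μ)
  have hL' : ∀ i : Fin m, ∫ ω, kk c a (ω i) ∂ρ = L := by
    intro i
    have mp : MeasurePreserving (Function.eval i) ρ μ := measurePreserving_eval (fun _ => μ) i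
    rw [hL, ← mp.map_eq, integral_map mp.measurable.aemeasurable]
    exact ((kk_meas c).comp (measurable_const.prodMk measurable_id)).aestronglyMeasurable
  have hQ' : ∀ i j : Fin m, i ≠ j → ∫ ω, kk c (ω i) (ω j) ∂ρ = Q := by
    intro i j hij
    have mpi : MeasurePreserving (Function.eval i) ρ μ := measurePreserving_eval (fun _ => μ) i
    have mpj : MeasurePreserving (Function.eval j) ρ μ := measurePreserving_eval (fun _ => μ) j
    have ind : iIndepFun (fun (i : Fin m) (ω : Fin m → ℝ) => ω i) ρ :=
      iIndepFun_pi (μ := fun _ : Fin m => μ) (X := fun _ => id) (fun _ => aemeasurable_id)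
    have h := (indepFun_iff_map_prod_eq_prod_map_map (measurable_pi_apply i).aemeasurable
      (measurable_pi_apply j).aemeasurable).mp (ind.indepFun hij)
    have h2 : ρ.map (fun ω : Fin m → ℝ => (ω i, ω j)) = μ.prod μ := by
      rw [h]
      congr 1
      · exact mpi.map_eq
      · exact mpj.map_eq
    rw [hQ, ← h2, integral_map (by fun_prop) (kk_meas c).aestronglyMeasurable]
  have hd : ∀ i j : Fin m, ∫ ω, kk c (ω i) (ω j) ∂ρ ≤ Q + if i = j then 2 - Q else 0 := by
    intro i j
    split_ifs with h
    · have : ∫ ω, kk c (ω i) (ω j) ∂ρ ≤ ∫ ω, (2 : ℝ) ∂ρ :=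
        integral_mono (kk_integrable _ _ _ _ (by fun_prop) (by fun_prop)) (integrable_const _)
          (fun ω => kk_le _ _ _)
      simp at this
      linarith
    · rw [hQ' i j h]; simp
  have hfin : ∀ ω : Fin m → ℝ, 0 ≤ (∑ i, ∑ j, kk c (ω i) (ω j)) +
      2 * p * (∑ i, kk c a (ω i)) + p ^ 2 * 2 := by
    intro ω
    have := finite_nonneg c hc (Sum.elim ω (fun _ : Fin p => a)) _ Finset.univ rfl
    simp only [Fintype.sum_sum_type, Sum.elim_inl, Sum.elim_inr, Finset.sum_const,
      Finset.card_univ, Fintype.card_fin, nsmul_eq_mul, Finset.sum_add_distrib] at this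
    have e : ∑ i, (p : ℝ) * kk c (ω i) a = p * ∑ i, kk c a (ω i) := by
      rw [Finset.mul_sum]; exact Finset.sum_congr rfl fun i _ => by rw [kk_symm]
    have h2 : (p : ℝ) * (p * kk c a a) ≤ p ^ 2 * 2 := by
      have := mul_le_mul_of_nonneg_left (kk_le c a a) (sq_nonneg (p : ℝ))
      linarith
    rw [e] at this
    linarith
  have hint : 0 ≤ ∫ ω, ((∑ i, ∑ j, kk c (ω i) (ω j)) +
      2 * p * (∑ i, kk c a (ω i)) + p ^ 2 * 2) ∂ρ := integral_nonneg fun ω => hfin ω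
  have i1 : ∀ i j : Fin m, Integrable (fun ω : Fin m → ℝ => kk c (ω i) (ω j)) ρ := fun i j =>
    kk_integrable _ _ _ _ (by fun_prop) (by fun_prop)
  have i2 : ∀ i : Fin m, Integrable (fun ω : Fin m → ℝ => kk c a (ω i)) ρ := fun i =>
    kk_integrable _ _ _ _ (by fun_prop) (by fun_prop)
  have i1' : Integrable (fun ω : Fin m → ℝ => ∑ i, ∑ j, kk c (ω i) (ω j)) ρ :=
    integrable_finsetSum _ fun i _ => integrable_finsetSum _ fun j _ => i1 i j
  have i2' : Integrable (fun ω : Fin m → ℝ => 2 * p * ∑ i, kk c a (ω i)) ρ :=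
    (integrable_finsetSum _ fun i _ => i2 i).const_mul _
  have i3' : Integrable (fun ω : Fin m → ℝ => (∑ i, ∑ j, kk c (ω i) (ω j)) +
      2 * p * ∑ i, kk c a (ω i)) ρ := i1'.add i2'
  rw [integral_add i3' (integrable_const _), integral_add i1' i2',
    integral_const_mul, integral_finsetSum _ (fun i _ => i2 i),
    integral_finsetSum _ (fun i _ => integrable_finsetSum _ fun j _ => i1 i j)] at hint
  simp only [hL', Finset.sum_const, Finset.card_univ, Fintype.card_fin, nsmul_eq_mul] at hint
  have hs : ∑ i : Fin m, ∫ ω, ∑ j, kk c (ω i) (ω j) ∂ρ ≤ m * (m * Q) + m * (2 - Q) := by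
    calc ∑ i : Fin m, ∫ ω, ∑ j, kk c (ω i) (ω j) ∂ρ
        = ∑ i : Fin m, ∑ j : Fin m, ∫ ω, kk c (ω i) (ω j) ∂ρ :=
          Finset.sum_congr rfl fun i _ => integral_finsetSum _ (fun j _ => i1 i j)
      _ ≤ ∑ i : Fin m, ∑ j : Fin m, (Q + if i = j then 2 - Q else 0) :=
          Finset.sum_le_sum fun i _ => Finset.sum_le_sum fun j _ => hd i j
      _ = m * (m * Q) + m * (2 - Q) := by
          simp [Finset.sum_add_distrib]
  simp at hint
  nlinarith

lemma L_nonneg (c : ℝ) (hc : 0 < c) (μ : Measure ℝ) [IsProbabilityMeasure μ]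
    (hQ : ∫ z, kk c z.1 z.2 ∂(μ.prod μ) ≤ 0) (a : ℝ) : 0 ≤ ∫ y, kk c a y ∂μ := by
  by_contra! h
  set L := ∫ y, kk c a y ∂μ
  set Q := ∫ z, kk c z.1 z.2 ∂(μ.prod μ)
  obtain ⟨n, hn⟩ := exists_nat_gt (2 / (-L))
  have hn0 : (0 : ℝ) < n := lt_trans (by apply div_pos <;> linarith) hn
  have hn1 : (1 : ℝ) ≤ n := by
    have : 0 < n := by exact_mod_cast hn0
    exact_mod_cast this
  have := sample c hc μ a (n ^ 2) n
  push_cast at this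
  rw [div_lt_iff₀ (by linarith)] at hn
  have h1 : (n : ℝ) ^ 2 * (n ^ 2 - 1) * Q ≤ 0 :=
    mul_nonpos_of_nonneg_of_nonpos (mul_nonneg (by positivity) (by nlinarith)) hQ
  have h2 : (n : ℝ) ^ 2 * (2 + n * L) < 0 := mul_neg_of_pos_of_neg (by positivity) (by linarith)
  change 0 ≤ (n : ℝ) ^ 2 * (n ^ 2 - 1) * Q + 2 * n ^ 2 + 2 * n ^ 2 * n * L + 2 * n ^ 2 at this
  nlinarith


lemma usc_D (c : ℝ) (μ : Measure ℝ) [IsProbabilityMeasure μ] :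
    UpperSemicontinuous (fun x => μ.real (Metric.closedBall x c)) := by
  intro x y hy
  have hn : ∃ R > 0, μ (Metric.cthickening R (Metric.closedBall x c)) ≠ ⊤ :=
    ⟨1, one_pos, measure_ne_top _ _⟩
  have h := tendsto_measure_cthickening_of_isClosed hn Metric.isClosed_closedBall
  have h' := (ENNReal.tendsto_toReal (measure_ne_top μ _)).comp h
  have h2 := h'.eventually_lt_const (u := y) hy
  rw [Metric.eventually_nhds_iff] at h2
  obtain ⟨δ, hδ, H⟩ := h2
  have H2 := H (y := δ / 2) (by simp [abs_of_pos hδ, hδ])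
  filter_upwards [Metric.ball_mem_nhds x (half_pos hδ)] with z hz
  refine lt_of_le_of_lt ?_ H2
  refine ENNReal.toReal_mono (measure_ne_top _ _) (measure_mono ?_)
  intro w hw
  rw [Metric.mem_closedBall, Real.dist_eq, abs_le] at hw
  rw [Metric.mem_ball, Real.dist_eq, abs_lt] at hz
  refine Metric.mem_cthickening_of_dist_le w (w - (z - x)) _ _ ?_ ?_
  · rw [Metric.mem_closedBall, Real.dist_eq, abs_le]
    constructor <;> linarith [hw.1, hw.2]
  · rw [Real.dist_eq, abs_le]
    constructor <;> linarith [hz.1, hz.2]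

lemma bdd_D (c : ℝ) (μ : Measure ℝ) [IsProbabilityMeasure μ] (M : ℝ) (hM : 0 < M) :
    IsCompact {x | M ≤ μ.real (Metric.closedBall x c)} := by
  have hcl : IsClosed {x | M ≤ μ.real (Metric.closedBall x c)} :=
    (usc_D c μ).isClosed_preimage M
  have hmono : Monotone (fun n : ℕ => Metric.closedBall (0 : ℝ) n) := fun a b hab =>
    Metric.closedBall_subset_closedBall (by exact_mod_cast hab)
  have h := tendsto_measure_iUnion_atTop (μ := μ) hmono
  rw [Metric.iUnion_closedBall_nat, measure_univ] at h
  have h' := (ENNReal.tendsto_toReal ENNReal.one_ne_top).comp h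
  obtain ⟨n, hn⟩ := (h'.eventually_const_lt (u := 1 - M) (by simpa using hM)).exists
  have hn' : 1 - M < μ.real (Metric.closedBall (0 : ℝ) n) := hn
  refine (isCompact_closedBall (0 : ℝ) (n + c)).of_isClosed_subset hcl ?_
  intro x hx
  by_contra hx2
  have hdis : Disjoint (Metric.closedBall x c) (Metric.closedBall (0 : ℝ) n) := by
    apply Metric.closedBall_disjoint_closedBall
    rw [Metric.mem_closedBall, not_le] at hx2
    linarith
  have := measureReal_union (μ := μ) hdis measurableSet_closedBall
  have h1 : μ.real (Metric.closedBall x c ∪ Metric.closedBall (0 : ℝ) n) ≤ 1 := measureReal_le_one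
  simp only [Set.mem_ofPred_eq] at hx
  linarith

lemma no_good (c : ℝ) (hc : 0 < c) (μ : Measure ℝ) [IsProbabilityMeasure μ]
    (hae : ∀ᵐ x ∂μ, μ.real (Metric.closedBall (-x) c) = 2 * μ.real (Metric.closedBall x c)) :
    False := by
  set D : ℝ → ℝ := fun x => μ.real (Metric.closedBall x c) with hD
  -- sets of positive mass contain good points
  have good : ∀ u : Set ℝ, 0 < μ.real u → ∃ y ∈ u, D (-y) = 2 * D y := by
    intro u hu
    by_contra! hcon
    have : μ u = 0 := measure_mono_null (fun y hy => hcon y hy) hae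
    rw [measureReal_def, this] at hu
    simp at hu
  -- a point with positive D
  obtain ⟨x0, hx0⟩ : ∃ x0, 0 < D x0 := by
    by_contra! hcon
    have : μ Set.univ = 0 := by
      have hU : (Set.univ : Set ℝ) ⊆ ⋃ k : ℤ, Metric.closedBall ((k : ℝ) * c) c := by
        intro x _
        refine Set.mem_iUnion.mpr ⟨⌊x / c⌋, ?_⟩
        rw [Metric.mem_closedBall, Real.dist_eq, abs_le]
        have h1 := Int.floor_le (x / c)
        have h2 := Int.lt_floor_add_one (x / c)
        rw [le_div_iff₀ hc] at h1
        rw [div_lt_iff₀ hc] at h2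
        constructor <;> nlinarith
      refine measure_mono_null hU (measure_iUnion_null fun k => ?_)
      have := le_antisymm (hcon ((k : ℝ) * c)) measureReal_nonneg
      simpa [D, measureReal_def, ENNReal.toReal_eq_zero_iff] using this
    simp at this
  obtain ⟨z0, hz0, hmax0⟩ := UpperSemicontinuousOn.exists_isMaxOn
    (s := {x | D x0 ≤ D x}) ⟨x0, le_refl (D x0)⟩ (bdd_D c μ _ hx0)
    ((usc_D c μ).upperSemicontinuousOn _)
  set M := D z0 with hM
  have hMpos : 0 < M := lt_of_lt_of_le hx0 hz0
  have hmax : ∀ x, D x ≤ M := by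
    intro x
    rcases le_total (D x0) (D x) with h | h
    · exact hmax0 h
    · exact h.trans hz0
  obtain ⟨z, hz, hzmax⟩ := (bdd_D c μ M hMpos).exists_isMaxOn ⟨z0, le_refl (D z0)⟩
    (continuous_abs.continuousOn (s := {x | M ≤ μ.real (Metric.closedBall x c)}))
  have hz' : M ≤ D z := hz
  have hzm : ∀ y, M ≤ D y → |y| ≤ |z| := fun y hy => hzmax hy
  -- sets of diameter at most c
  have small : ∀ u : Set ℝ, (∀ a ∈ u, ∀ b ∈ u, |a - b| ≤ c) → ∀ y ∈ u, μ.real u ≤ D y := by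
    intro u hu y hy
    refine measureReal_mono ?_
    intro w hw
    exact hu w hw y hy
  have half : ∀ u : Set ℝ, (∀ a ∈ u, ∀ b ∈ u, |a - b| ≤ c) → μ.real u ≤ M / 2 := by
    intro u hu
    by_contra! hcon
    obtain ⟨y, hy, hyD⟩ := good u (by linarith)
    have := small u hu y hy
    linarith [hmax (-y)]
  have fin : ∀ u v : Set ℝ, (∀ a ∈ u, ∀ b ∈ u, |a - b| ≤ c) → (∀ a ∈ v, ∀ b ∈ v, |a - b| ≤ c) →
      Metric.closedBall z c ⊆ u ∪ v → (∀ a ∈ u, |z| < |a|) → False := by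
    intro u v hu hv huv hlt
    have h1 : D z ≤ μ.real u + μ.real v :=
      (measureReal_mono huv).trans (measureReal_union_le _ _)
    have h2 := half v hv
    obtain ⟨y, hy, hyD⟩ := good u (by linarith)
    have h3 := small u hu y hy
    have h4 := hzm (-y) (by linarith)
    rw [abs_neg] at h4
    exact absurd h4 (not_le.mpr (hlt y hy))
  rcases le_total 0 z with h0 | h0
  · refine fin (Set.Ioc z (z + c)) (Set.Icc (z - c) z) ?_ ?_ ?_ ?_
    · rintro a ⟨h1, h2⟩ b ⟨h3, h4⟩
      rw [abs_le]; constructor <;> linarith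
    · rintro a ⟨h1, h2⟩ b ⟨h3, h4⟩
      rw [abs_le]; constructor <;> linarith
    · rw [Real.closedBall_eq_Icc]
      rintro a ⟨h1, h2⟩
      rcases le_or_gt a z with h | h
      · exact Or.inr ⟨h1, h⟩
      · exact Or.inl ⟨h, h2⟩
    · rintro a ⟨h1, h2⟩
      rw [abs_of_nonneg h0, lt_abs]; left; exact h1
  · refine fin (Set.Ico (z - c) z) (Set.Icc z (z + c)) ?_ ?_ ?_ ?_
    · rintro a ⟨h1, h2⟩ b ⟨h3, h4⟩
      rw [abs_le]; constructor <;> linarith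
    · rintro a ⟨h1, h2⟩ b ⟨h3, h4⟩
      rw [abs_le]; constructor <;> linarith
    · rw [Real.closedBall_eq_Icc]
      rintro a ⟨h1, h2⟩
      rcases lt_or_ge a z with h | h
      · exact Or.inl ⟨h1, h⟩
      · exact Or.inr ⟨h, h2⟩
    · rintro a ⟨h1, h2⟩
      rw [abs_of_nonpos h0, lt_abs]; right; linarith

lemma integral_kk {α : Type*} [MeasurableSpace α] (ν : Measure α) [IsFiniteMeasure ν] (c : ℝ)
    (f g : α → ℝ) (hf : Measurable f) (hg : Measurable g) :
    ∫ a, kk c (f a) (g a) ∂ν = 2 * ν.real {a | |f a - g a| ≤ c} - ν.real {a | |f a + g a| ≤ c} := by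
  have m1 : MeasurableSet {a | |f a - g a| ≤ c} := measurableSet_le (by fun_prop) measurable_const
  have m2 : MeasurableSet {a | |f a + g a| ≤ c} := measurableSet_le (by fun_prop) measurable_const
  have e : (fun a => kk c (f a) (g a)) = fun a =>
      2 * ({a | |f a - g a| ≤ c}.indicator (fun _ => (1 : ℝ)) a) -
      {a | |f a + g a| ≤ c}.indicator (fun _ => (1 : ℝ)) a := by
    funext a
    simp [kk, Set.indicator_apply]
  rw [e, integral_sub (((integrable_const 1).indicator m1).const_mul 2)
    ((integrable_const 1).indicator m2), integral_const_mul, integral_indicator_const _ m1,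
    integral_indicator_const _ m2]
  simp

theorem stmt_0 {Ω : Type*} [MeasurableSpace Ω] (P : Measure Ω) [IsProbabilityMeasure P]
    (X Y : Ω → ℝ) (hX : Measurable X) (hY : Measurable Y)
    (hindep : IndepFun X Y P) (hid : IdentDistrib X Y P P) (c : ℝ) (hc : 0 < c) :
    P {ω | |X ω + Y ω| ≤ c} < 2 * P {ω | |X ω - Y ω| ≤ c} := by
  by_contra! hcon
  have hcon' : 2 * P.real {ω | |X ω - Y ω| ≤ c} ≤ P.real {ω | |X ω + Y ω| ≤ c} := by
    have := ENNReal.toReal_mono (measure_ne_top P _) hcon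
    simpa [measureReal_def] using this
  let μ : Measure ℝ := P.map X
  have : IsProbabilityMeasure μ := Measure.isProbabilityMeasure_map hX.aemeasurable
  have hprod : P.map (fun ω => (X ω, Y ω)) = μ.prod μ := by
    rw [(indepFun_iff_map_prod_eq_prod_map_map hX.aemeasurable hY.aemeasurable).mp hindep,
      ← hid.map_eq]
  have hQ : ∫ z, kk c z.1 z.2 ∂(μ.prod μ) ≤ 0 := by
    rw [← hprod, integral_map (hX.prodMk hY).aemeasurable (kk_meas c).aestronglyMeasurable]
    rw [integral_kk P c X Y hX hY]
    linarith
  have hL := L_nonneg c hc μ hQ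
  have hint : Integrable (fun z : ℝ × ℝ => kk c z.1 z.2) (μ.prod μ) :=
    kk_integrable _ _ _ _ measurable_fst measurable_snd
  have hQ2 : ∫ x, ∫ y, kk c x y ∂μ ∂μ = 0 := by
    refine le_antisymm ?_ (integral_nonneg hL)
    rw [← integral_prod _ hint]
    exact hQ
  have hae := (integral_eq_zero_iff_of_nonneg hL hint.integral_prod_left).mp hQ2
  refine no_good c hc μ ?_
  filter_upwards [hae] with x hx
  have hx' : ∫ y, kk c x y ∂μ = 0 := hx
  rw [integral_kk μ c (fun _ => x) (fun y => y) measurable_const measurable_id] at hx'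
  have e1 : {y : ℝ | |x - y| ≤ c} = Metric.closedBall x c := by
    ext y; simp [Real.dist_eq, abs_sub_comm]
  have e2 : {y : ℝ | |x + y| ≤ c} = Metric.closedBall (-x) c := by
    ext y; simp [Real.dist_eq, add_comm]
  rw [e1, e2] at hx'
  linarith
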